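/- arXiv:2505.09468 — 4 statements merged into one kernel-verified Lean document; each statement's English description precedes it below -/
import Mathlib

section
/- For every n ≥ 1, the center of the group (Gₙ, ⊛) equals {(ε|0|0) : ε ∈ ℤ₄}, this subgroup is isomorphic as a group to ℤ₄, and consequently (Gₙ, ⊛) is non-abelian. -/
open Matrix

abbrev GG (n : ℕ) := ZMod 4 × (Fin n → ZMod 2) × (Fin n → ZMod 2)

def dotF2 {n : ℕ} (a b : Fin n → ZMod 2) : ZMod 2 := ∑ j, a j * b j

def lift24 (x : ZMod 2) : ZMod 4 := (x.val : ZMod 4)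

def gop {n : ℕ} (p q : GG n) : GG n :=
  (p.1 + q.1 + 2 * lift24 (dotF2 p.2.2 q.2.1), p.2.1 + q.2.1, p.2.2 + q.2.2)

theorem two_mul_lift24_injective : Function.Injective fun x : ZMod 2 => 2 * lift24 x := by
  unfold lift24
  decide

theorem gop_comm_iff {n : ℕ} (a b : GG n) :
    gop a b = gop b a ↔ dotF2 a.2.2 b.2.1 = dotF2 b.2.2 a.2.1 := by
  rw [← two_mul_lift24_injective.eq_iff]
  simp [gop, Prod.ext_iff, add_comm b.1, add_comm b.2.1, add_comm b.2.2]

theorem gop_central_iff {n : ℕ} (a : GG n) :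
    (∀ b : GG n, gop a b = gop b a) ↔ a.2.1 = 0 ∧ a.2.2 = 0 := by
  simp only [gop_comm_iff]
  constructor
  · intro h
    constructor
    · ext j
      simpa [dotF2, Pi.single_apply] using (h (0, 0, Pi.single j 1)).symm
    · ext j
      simpa [dotF2, Pi.single_apply] using h (0, Pi.single j 1, 0)
  · rintro ⟨h₁, h₂⟩ b
    simp [dotF2, h₁, h₂]

theorem gop_scalar {n : ℕ} (x y : ZMod 4) :
    gop ((x, 0, 0) : GG n) (y, 0, 0) = (x + y, 0, 0) := by
  simp [gop, dotF2, lift24]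

/-- The scalars `(ε|0|0)` enumerate the center. -/
def centerEquiv (n : ℕ) : ZMod 4 ≃ {a : GG n // ∀ b : GG n, gop a b = gop b a} where
  toFun x := ⟨(x, 0, 0), (gop_central_iff _).2 ⟨rfl, rfl⟩⟩
  invFun a := a.1.1
  left_inv _ := rfl
  right_inv a := by
    obtain ⟨h₁, h₂⟩ := (gop_central_iff a.1).1 a.2
    exact Subtype.ext (Prod.ext rfl (Prod.ext h₁.symm h₂.symm))

/-- For every n ≥ 1, the center of (Gₙ, ⊛) equals {(ε|0|0) : ε ∈ ℤ₄},
this subgroup is isomorphic as a group to ℤ₄ (the isomorphism being multiplicative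
from (ℤ₄, +) onto the center), and consequently (Gₙ, ⊛) is non-abelian. -/
theorem stmt1 (n : ℕ) (hn : 1 ≤ n) :
    ({a : GG n | ∀ b : GG n, gop a b = gop b a} =
      {a : GG n | a.2.1 = 0 ∧ a.2.2 = 0}) ∧
    (∃ f : ZMod 4 ≃ {a : GG n // ∀ b : GG n, gop a b = gop b a},
      ∀ x y : ZMod 4, (f (x + y) : GG n) = gop (f x : GG n) (f y : GG n)) ∧
    ¬ (∀ a b : GG n, gop a b = gop b a) := by
  refine ⟨Set.ext gop_central_iff, ⟨centerEquiv n, fun x y => (gop_scalar x y).symm⟩, fun h => ?_⟩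
  have h₁ := ((gop_central_iff ((0, 1, 0) : GG n)).1 (h _)).1
  exact one_ne_zero (congrFun h₁ ⟨0, hn⟩)
end

section
/- Fix distinct indices c ≠ t in {1,…,n} and let CNOT_{c→t} be the 2ⁿ×2ⁿ permutation matrix with (u,v)-entry [u = v + v_c·e_t]. Then for every ε ∈ ℤ₄ and ξ, ζ ∈ 𝔽₂ⁿ: CNOT_{c→t} · P(ε,ξ,ζ) · CNOT_{c→t}† = P(ε | ξ + ξ_c·e_t | ζ + ζ_t·e_c), with additions in 𝔽₂ⁿ and e_j the j-th standard basis vector of 𝔽₂ⁿ. -/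
open Matrix

abbrev PMat (n : ℕ) := Matrix (Fin n → ZMod 2) (Fin n → ZMod 2) ℂ

noncomputable def PauliOp {n : ℕ} (ε : ZMod 4) (ξ ζ : Fin n → ZMod 2) : PMat n :=
  fun u v => Complex.I ^ ε.val * (-1 : ℂ) ^ (dotF2 ζ v).val * (if u = v + ξ then 1 else 0)

def eVec {n : ℕ} (t : Fin n) : Fin n → ZMod 2 := fun j => if j = t then 1 else 0

/-- CNOT with control c and target t: (u,v)-entry [u = v + v_c·e_t]. -/
noncomputable def CNOTgate {n : ℕ} (c t : Fin n) : PMat n :=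
  fun u v => if u = v + v c • eVec t then 1 else 0

/-- The action `v ↦ v + v_c·e_t` of the CNOT gate on bit vectors. -/
def cnotMap {n : ℕ} (c t : Fin n) (v : Fin n → ZMod 2) : Fin n → ZMod 2 :=
  v + v c • eVec t

lemma cnotMap_add {n : ℕ} (c t : Fin n) (v w : Fin n → ZMod 2) :
    cnotMap c t (v + w) = cnotMap c t v + cnotMap c t w := by
  simp only [cnotMap, Pi.add_apply, add_smul]
  abel

lemma cnotMap_involutive {n : ℕ} {c t : Fin n} (hct : c ≠ t) :
    Function.Involutive (cnotMap c t) := by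
  intro v
  have hc : (v + v c • eVec t) c = v c := by simp [eVec, hct]
  rw [cnotMap, cnotMap, hc, add_assoc, ← add_smul, CharTwo.add_self_eq_zero, zero_smul,
    add_zero]

lemma CNOTgate_apply {n : ℕ} {c t : Fin n} (hct : c ≠ t) (u v : Fin n → ZMod 2) :
    CNOTgate c t u v = if v = cnotMap c t u then 1 else 0 := by
  have h : u = cnotMap c t v ↔ v = cnotMap c t u :=
    eq_comm.trans (cnotMap_involutive hct).eq_iff
  exact if_congr h rfl rfl

lemma CNOTgate_conj_apply {n : ℕ} {c t : Fin n} (hct : c ≠ t) (M : PMat n)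
    (u v : Fin n → ZMod 2) :
    (CNOTgate c t * M * (CNOTgate c t)ᴴ) u v = M (cnotMap c t u) (cnotMap c t v) := by
  simp [Matrix.mul_apply, Matrix.conjTranspose_apply, CNOTgate_apply hct, apply_ite]

lemma dotF2_cnotMap {n : ℕ} (c t : Fin n) (ζ v : Fin n → ZMod 2) :
    dotF2 ζ (cnotMap c t v) = dotF2 (cnotMap t c ζ) v := by
  simp [dotF2, cnotMap, eVec, mul_add, Finset.sum_add_distrib, mul_comm]

/-- CNOT_{c→t} · P(ε,ξ,ζ) · CNOT_{c→t}† = P(ε | ξ + ξ_c·e_t | ζ + ζ_t·e_c). -/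
theorem stmt9 (n : ℕ) (c t : Fin n) (hct : c ≠ t) (ε : ZMod 4) (ξ ζ : Fin n → ZMod 2) :
    CNOTgate c t * PauliOp ε ξ ζ * (CNOTgate c t)ᴴ =
      PauliOp ε (ξ + ξ c • eVec t) (ζ + ζ t • eVec c) := by
  ext u v
  have h : cnotMap c t u = cnotMap c t v + ξ ↔ u = v + cnotMap c t ξ := by
    rw [(cnotMap_involutive hct).eq_iff, cnotMap_add, cnotMap_involutive hct v]
  rw [CNOTgate_conj_apply hct]
  simp only [PauliOp, dotF2_cnotMap, h]
  rfl
end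

section
/- A (2n+1)-tuple M of elements of Gₙ is the flow tableau of some Clifford unitary C (i.e. M = F(C) for some C ∈ Clₙ) if and only if: the 0-th row of M equals (1|0|0), every other row of M is proper, and M is symplectic. -/
open Matrix

/-- A Clifford unitary: a unitary matrix normalizing the Pauli group
(under right conjugation C† P C). -/
def IsCliffordUnitary {n : ℕ} (C : PMat n) : Prop :=
  C * Cᴴ = 1 ∧ Cᴴ * C = 1 ∧
  ∀ p : GG n, ∃ q : GG n, Cᴴ * PauliOp p.1 p.2.1 p.2.2 * C = PauliOp q.1 q.2.1 q.2.2

/-- The generators g₀ = iI, g_j = P(0,e_j,0) (1 ≤ j ≤ n), g_{n+j} = P(0,0,e_j). -/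
noncomputable def gens (n : ℕ) (i : Fin (2 * n + 1)) : PMat n :=
  if _h0 : i.val = 0 then Complex.I • (1 : PMat n)
  else if h1 : i.val ≤ n then PauliOp 0 (eVec ⟨i.val - 1, by have := i.isLt; omega⟩) 0
  else PauliOp 0 0 (eVec ⟨i.val - 1 - n, by have := i.isLt; omega⟩)

/-- M is the flow tableau of C: row i presents C† gᵢ C, i.e. ρ(C† gᵢ C) = Mᵢ. -/
def IsFlowTableau {n : ℕ} (C : PMat n) (M : Fin (2 * n + 1) → GG n) : Prop :=
  ∀ i, PauliOp (M i).1 (M i).2.1 (M i).2.2 = Cᴴ * gens n i * C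

/-- M is the Clifford tableau of C: row i presents C gᵢ C†, i.e. ρ(C gᵢ C†) = Mᵢ. -/
def IsCliffordTableau {n : ℕ} (C : PMat n) (M : Fin (2 * n + 1) → GG n) : Prop :=
  ∀ i, PauliOp (M i).1 (M i).2.1 (M i).2.2 = C * gens n i * Cᴴ

/-- Row index 1,…,2n of a tableau, indexed by Fin n ⊕ Fin n. -/
def rowIdx (n : ℕ) : Fin n ⊕ Fin n → Fin (2 * n + 1)
  | .inl j => ⟨j.val + 1, by have := j.isLt; omega⟩
  | .inr j => ⟨n + j.val + 1, by have := j.isLt; omega⟩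

/-- The phaseless 2n×2n block of a tableau over 𝔽₂: row i is (ξᵢ | ζᵢ). -/
def tabBlock {n : ℕ} (M : Fin (2 * n + 1) → GG n) :
    Matrix (Fin n ⊕ Fin n) (Fin n ⊕ Fin n) (ZMod 2) :=
  fun i => Sum.elim (M (rowIdx n i)).2.1 (M (rowIdx n i)).2.2

/-- Ω = ((0,I),(I,0)). -/
def Ωblk (n : ℕ) : Matrix (Fin n ⊕ Fin n) (Fin n ⊕ Fin n) (ZMod 2) :=
  Matrix.fromBlocks 0 1 1 0

/-- The i-th bit (1 ≤ i ≤ 2n) of the phaseless part of ϱ ∈ Gₙ. -/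
def bitOf {n : ℕ} (ϱ : GG n) (i : Fin (2 * n)) : ZMod 2 :=
  if h : i.val < n then ϱ.2.1 ⟨i.val, h⟩
  else ϱ.2.2 ⟨i.val - n, by have := i.isLt; omega⟩

/-- The vector–tableau product ϱ ⊛ M := (ϱ₀·ε₀|0|0) ⊛ m_{i₁} ⊛ ⋯ ⊛ m_{i_k}
over the indices i ≥ 1 with ϱᵢ = 1, in increasing order. -/
def starVecMul {n : ℕ} (ϱ : GG n) (M : Fin (2 * n + 1) → GG n) : GG n :=
  (((List.finRange (2 * n)).filter (fun i => decide (bitOf ϱ i = 1))).map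
    (fun i => M i.succ)).foldl gop (ϱ.1 * (M 0).1, 0, 0)

section Phases

theorem neg_one_pow_val_add (x y : ZMod 2) :
    (-1 : ℂ) ^ (x + y).val = (-1) ^ x.val * (-1) ^ y.val := by
  rw [ZMod.val_add, ← neg_one_pow_eq_pow_mod_two, pow_add]

theorem neg_one_pow_val_injective {x y : ZMod 2}
    (h : (-1 : ℂ) ^ x.val = (-1) ^ y.val) : x = y := by
  have hne : (1 : ℂ) ≠ -1 := by norm_num
  fin_cases x <;> fin_cases y <;> first | rfl | (simp [ZMod.val] at h; grind)

theorem I_pow_val_add (x y : ZMod 4) :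
    Complex.I ^ (x + y).val = Complex.I ^ x.val * Complex.I ^ y.val := by
  rw [ZMod.val_add, ← Complex.I_pow_eq_pow_mod, pow_add]

theorem I_pow_val_two_mul_lift24 (x : ZMod 2) :
    Complex.I ^ (2 * lift24 x).val = (-1 : ℂ) ^ x.val := by
  have h : ∀ x : ZMod 2, (2 * lift24 x).val = 2 * x.val := by decide
  rw [h, pow_mul, Complex.I_sq]

theorem I_pow_val_injective {x y : ZMod 4}
    (h : Complex.I ^ x.val = Complex.I ^ y.val) : x = y := by
  have h1 : (Complex.I ^ (x - y).val) = 1 := by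
    have h2 := I_pow_val_add (x - y) y
    rw [sub_add_cancel, h] at h2
    exact (mul_eq_right₀ (pow_ne_zero _ Complex.I_ne_zero)).1 h2.symm
  rw [← sub_eq_zero]
  generalize x - y = z at h1
  fin_cases z
  · rfl
  · simp [ZMod.val, Complex.ext_iff] at h1
  · simp [ZMod.val] at h1; norm_num at h1
  · simp [ZMod.val, Complex.I_pow_three, Complex.ext_iff] at h1

theorem conj_I_pow_val (x : ZMod 4) :
    star (Complex.I ^ x.val) = Complex.I ^ (-x).val := by
  have h : Complex.I ^ (-x).val * Complex.I ^ x.val = 1 := by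
    rw [← I_pow_val_add]; simp
  have h' : star (Complex.I ^ x.val) * Complex.I ^ x.val = 1 := by
    rw [star_pow, ← mul_pow]; simp
  exact mul_right_cancel₀ (pow_ne_zero _ Complex.I_ne_zero) (h'.trans h.symm)

end Phases

section Pauli

variable {n : ℕ}

theorem dotF2_eq_dotProduct (a b : Fin n → ZMod 2) : dotF2 a b = a ⬝ᵥ b := rfl

theorem bits_add_self (x : Fin n → ZMod 2) : x + x = 0 :=
  funext fun _ => CharTwo.add_self_eq_zero _

theorem eVec_eq_single (t : Fin n) : eVec t = Pi.single t 1 := by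
  ext j
  simp [eVec, Pi.single_apply]

theorem dotF2_eVec (a : Fin n → ZMod 2) (t : Fin n) : dotF2 a (eVec t) = a t := by
  simp [dotF2_eq_dotProduct, eVec_eq_single]

/-- The Pauli operator of an element of `GG n`. -/
noncomputable def pauli (p : GG n) : PMat n := PauliOp p.1 p.2.1 p.2.2

theorem pauli_apply (p : GG n) (u v : Fin n → ZMod 2) :
    pauli p u v = Complex.I ^ p.1.val * (-1 : ℂ) ^ (dotF2 p.2.2 v).val *
      (if u = v + p.2.1 then 1 else 0) := rfl

theorem pauli_mul (p q : GG n) : pauli p * pauli q = pauli (gop p q) := by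
  ext u w
  rw [Matrix.mul_apply, Finset.sum_eq_single (w + q.2.1)]
  · simp only [pauli_apply, gop, I_pow_val_add, I_pow_val_two_mul_lift24, dotF2_eq_dotProduct,
      dotProduct_add, add_dotProduct, neg_one_pow_val_add, if_true,
      show w + (p.2.1 + q.2.1) = w + q.2.1 + p.2.1 by abel]
    ring
  · intro v _ hv
    simp [pauli_apply, hv]
  · simp

theorem pauli_one : pauli (0 : GG n) = 1 := by
  ext u v
  simp [pauli_apply, dotF2_eq_dotProduct, Matrix.one_apply]

theorem pauli_one_zero : pauli ((1, 0, 0) : GG n) = Complex.I • 1 := by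
  ext u v
  simp [pauli_apply, dotF2_eq_dotProduct, Matrix.one_apply, ZMod.val_one'']

theorem pauli_conjTranspose (p : GG n) :
    (pauli p)ᴴ = pauli (-p.1 + 2 * lift24 (dotF2 p.2.2 p.2.1), p.2.1, p.2.2) := by
  ext u v
  have hx := bits_add_self p.2.1
  by_cases h : u = v + p.2.1
  · subst h
    have h' : v = v + p.2.1 + p.2.1 := by rw [add_assoc, hx, add_zero]
    rw [Matrix.conjTranspose_apply, pauli_apply, pauli_apply, if_pos h', if_pos rfl]
    rw [star_mul', star_mul', conj_I_pow_val, star_pow, star_neg, star_one]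
    simp only [I_pow_val_add, I_pow_val_two_mul_lift24, dotF2_eq_dotProduct, dotProduct_add,
      neg_one_pow_val_add]
    ring
  · have h' : ¬ v = u + p.2.1 := by
      rintro rfl
      exact h (by rw [add_assoc, hx, add_zero])
    simp [pauli_apply, h, h']

theorem pauli_injective : Function.Injective (pauli : GG n → PMat n) := by
  rintro ⟨a, x, z⟩ ⟨b, y, w⟩ h
  have h0 := congrFun (congrFun h x) 0
  obtain rfl : x = y := by
    by_contra hxy
    simp [pauli_apply, hxy] at h0
  obtain rfl : a = b := I_pow_val_injective (by simpa [pauli_apply, dotF2_eq_dotProduct] using h0)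
  obtain rfl : z = w := by
    ext t
    have ht := congrFun (congrFun h (eVec t + x)) (eVec t)
    simp only [pauli_apply, if_true, mul_one, dotF2_eVec] at ht
    exact neg_one_pow_val_injective (mul_left_cancel₀ (pow_ne_zero _ Complex.I_ne_zero) ht)
  rfl

theorem pauli_mul_conjTranspose (p : GG n) : pauli p * (pauli p)ᴴ = 1 := by
  rw [pauli_conjTranspose, pauli_mul, ← pauli_one]
  congr 1
  have h : ∀ x : ZMod 2, (2 * lift24 x + 2 * lift24 x) = 0 := by decide
  refine Prod.ext ?_ (Prod.ext (bits_add_self _) (bits_add_self _))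
  simp only [gop, Prod.fst_zero]
  rw [← add_assoc, add_neg_cancel, zero_add, h]

theorem pauli_ne_zero (p : GG n) : pauli p ≠ 0 := by
  intro h
  have := pauli_mul_conjTranspose p
  simp [h] at this

/-- The symplectic form on the phaseless parts of two elements of `GG n`. -/
def sympForm (p q : GG n) : ZMod 2 := dotF2 p.2.2 q.2.1 + dotF2 q.2.2 p.2.1

theorem pauli_mul_comm (p q : GG n) :
    pauli p * pauli q = (-1 : ℂ) ^ (sympForm p q).val • (pauli q * pauli p) := by
  rw [pauli_mul, pauli_mul]
  ext u v
  have hs : ((-1 : ℂ) ^ (dotF2 q.2.2 p.2.1).val) * (-1 : ℂ) ^ (dotF2 q.2.2 p.2.1).val = 1 := by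
    rw [← mul_pow]; simp
  simp only [pauli_apply, gop, Matrix.smul_apply, smul_eq_mul, I_pow_val_add,
    I_pow_val_two_mul_lift24, sympForm, neg_one_pow_val_add, add_comm p.2.1, add_comm p.2.2]
  linear_combination (-Complex.I ^ p.1.val * Complex.I ^ q.1.val *
    (-1 : ℂ) ^ (dotF2 p.2.2 q.2.1).val * (-1 : ℂ) ^ (dotF2 (q.2.2 + p.2.2) v).val *
      (if u = v + (q.2.1 + p.2.1) then 1 else 0)) * hs

theorem pauli_isHermitian_iff (p : GG n) :
    (pauli p).IsHermitian ↔ (p.1.val + (dotF2 p.2.2 p.2.1).val) % 2 = 0 := by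
  rw [Matrix.IsHermitian, pauli_conjTranspose, pauli_injective.eq_iff, Prod.ext_iff]
  have h : ∀ (a : ZMod 4) (x : ZMod 2),
      -a + 2 * lift24 x = a ↔ (a.val + x.val) % 2 = 0 := by decide
  simpa using h _ _

/-- The element of `GG n` presenting the generator with index `rowIdx n i`. -/
def genElem : Fin n ⊕ Fin n → GG n
  | .inl j => (0, eVec j, 0)
  | .inr j => (0, 0, eVec j)

theorem gens_zero : gens n 0 = pauli (1, 0, 0) := by
  simp [gens, pauli_one_zero]

theorem gens_rowIdx (i : Fin n ⊕ Fin n) : gens n (rowIdx n i) = pauli (genElem i) := by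
  rcases i with j | j
  · have := j.isLt
    simp [gens, rowIdx, genElem, pauli, this]
  · simp [gens, rowIdx, genElem, pauli]

theorem eq_zero_or_rowIdx (i : Fin (2 * n + 1)) : i = 0 ∨ ∃ k, i = rowIdx n k := by
  by_cases h0 : i.val = 0
  · exact Or.inl (Fin.ext h0)
  · right
    have := i.isLt
    by_cases h1 : i.val ≤ n
    · exact ⟨.inl ⟨i.val - 1, by omega⟩, Fin.ext (by simp only [rowIdx]; omega)⟩
    · exact ⟨.inr ⟨i.val - 1 - n, by omega⟩, Fin.ext (by simp only [rowIdx]; omega)⟩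

theorem genElem_isHermitian (i : Fin n ⊕ Fin n) : (pauli (genElem i)).IsHermitian := by
  rw [pauli_isHermitian_iff]
  rcases i with j | j <;> simp [genElem, dotF2_eq_dotProduct]

theorem sympForm_genElem (i k : Fin n ⊕ Fin n) :
    sympForm (genElem i) (genElem k) = Ωblk n i k := by
  rcases i with i | i <;> rcases k with k | k <;>
    simp [sympForm, genElem, Ωblk, dotF2_eq_dotProduct, eVec_eq_single, Matrix.one_apply,
      Pi.single_apply, eq_comm]

theorem tabBlock_mul_apply (M : Fin (2 * n + 1) → GG n) (i k : Fin n ⊕ Fin n) :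
    (tabBlock M * Ωblk n * (tabBlock M)ᵀ) i k =
      sympForm (M (rowIdx n i)) (M (rowIdx n k)) := by
  simp [Matrix.mul_apply, Fintype.sum_sum_type, tabBlock, Ωblk, sympForm, dotF2,
    Matrix.one_apply, mul_comm]

theorem bits_induction {Q : (Fin n → ZMod 2) → Prop} (h0 : Q 0)
    (hadd : ∀ j v, Q v → Q (eVec j + v)) (v : Fin n → ZMod 2) : Q v := by
  have h : ∀ s : Finset (Fin n), Q (∑ j ∈ s, Pi.single j (v j)) := by
    intro s
    induction s using Finset.induction_on with
    | empty => simpa using h0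
    | insert j s hj ih =>
      rw [Finset.sum_insert hj]
      have hbit : ∀ c : ZMod 2, c = 0 ∨ c = 1 := by decide
      rcases hbit (v j) with hc | hc
      · rwa [hc, Pi.single_zero, zero_add]
      · rw [hc, ← eVec_eq_single]
        exact hadd j _ ih
  simpa [Finset.univ_sum_single] using h Finset.univ

theorem pauli_induction {Q : PMat n → Prop} (hmul : ∀ a b, Q a → Q b → Q (a * b))
    (h1 : Q 1) (hI : Q (pauli (1, 0, 0))) (hg : ∀ i, Q (pauli (genElem i))) (p : GG n) :
    Q (pauli p) := by
  have h0 : Q (pauli (0, 0, 0)) := by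
    rw [show pauli ((0, 0, 0) : GG n) = 1 from pauli_one]
    exact h1
  have hε : ∀ k : ℕ, Q (pauli ((k : ZMod 4), 0, 0)) := by
    intro k
    induction k with
    | zero => simpa using h0
    | succ k ih =>
      have := hmul _ _ ih hI
      rw [pauli_mul] at this
      simpa [gop, dotF2_eq_dotProduct, lift24] using this
  have hξ : ∀ x : Fin n → ZMod 2, Q (pauli (0, x, 0)) := by
    refine bits_induction h0 fun j v hv => ?_
    have := hmul _ _ (hg (.inl j)) hv
    rw [pauli_mul] at this
    simpa [gop, genElem, dotF2_eq_dotProduct, lift24] using this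
  have hζ : ∀ x : Fin n → ZMod 2, Q (pauli (0, 0, x)) := by
    refine bits_induction h0 fun j v hv => ?_
    have := hmul _ _ (hg (.inr j)) hv
    rw [pauli_mul] at this
    simpa [gop, genElem, dotF2_eq_dotProduct, lift24] using this
  have := hmul _ _ (hmul _ _ (hε p.1.val) (hξ p.2.1)) (hζ p.2.2)
  rw [pauli_mul, pauli_mul] at this
  simpa [gop, dotF2_eq_dotProduct, lift24] using this

end Pauli

section Intertwiner

variable {n : ℕ}

/-- Ordered products of pairwise commuting involutions, indexed by bit vectors. -/
theorem exists_involution_products {R : Type*} [Monoid R] (x : Fin n → R)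
    (hcomm : ∀ i j, Commute (x i) (x j)) (hsq : ∀ i, x i * x i = 1) :
    ∃ D : (Fin n → ZMod 2) → R, D 0 = 1 ∧ ∀ j v, D (eVec j + v) = x j * D v := by
  let φ : ∀ _ : Fin n, Multiplicative (ZMod 2) →* R := fun i =>
    { toFun := fun c => x i ^ c.toAdd.val
      map_one' := by simp
      map_mul' := fun a b => by
        rw [toAdd_mul, ZMod.val_add, ← pow_eq_pow_mod _ ((sq _).trans (hsq i)), pow_add] }
  have hφ : Pairwise fun i j => ∀ a b, Commute (φ i a) (φ j b) :=
    fun i j _ a b => (hcomm i j).pow_pow _ _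
  let Φ := MonoidHom.noncommPiCoprod φ hφ
  refine ⟨fun v => Φ fun i => Multiplicative.ofAdd (v i), map_one Φ, fun j v => ?_⟩
  have hj : (fun i => Multiplicative.ofAdd ((eVec j + v) i)) =
      Pi.mulSingle j (Multiplicative.ofAdd 1) * fun i => Multiplicative.ofAdd (v i) := by
    funext i
    rw [eVec_eq_single, Pi.add_apply, ofAdd_add, Pi.mul_apply]
    congr 1
  have hx : φ j (Multiplicative.ofAdd 1) = x j := pow_one _
  beta_reduce
  rw [hj, map_mul, MonoidHom.noncommPiCoprod_mulSingle, hx]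

theorem exists_joint_eigenvector {ι m : Type*} [Fintype ι] [DecidableEq ι] [Fintype m]
    [DecidableEq m] [Nonempty m] (Z : ι → Matrix m m ℂ) (hcomm : ∀ i j, Commute (Z i) (Z j))
    (hsq : ∀ i, Z i * Z i = 1) :
    ∃ (ψ : m → ℂ) (σ : ι → ZMod 2), ψ ≠ 0 ∧ ∀ j, Z j *ᵥ ψ = (-1 : ℂ) ^ (σ j).val • ψ := by
  have key : ∀ s : Finset ι, ∃ (ψ : m → ℂ) (σ : ι → ZMod 2), ψ ≠ 0 ∧
      ∀ j ∈ s, Z j *ᵥ ψ = (-1 : ℂ) ^ (σ j).val • ψ := by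
    intro s
    induction s using Finset.induction_on with
    | empty =>
      obtain ⟨w⟩ := ‹Nonempty m›
      exact ⟨Pi.single w 1, 0, by simp, by simp⟩
    | insert i s hi ih =>
      obtain ⟨ψ, σ, hψ, h⟩ := ih
      have hne : ∀ j ∈ s, j ≠ i := fun j hj e => hi (e ▸ hj)
      by_cases h0 : ψ + Z i *ᵥ ψ = 0
      · refine ⟨ψ, Function.update σ i 1, hψ, fun j hj => ?_⟩
        rcases Finset.mem_insert.1 hj with rfl | hj
        · simpa [ZMod.val_one] using eq_neg_of_add_eq_zero_right h0
        · rw [Function.update_of_ne (hne j hj), h j hj]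
      · refine ⟨ψ + Z i *ᵥ ψ, Function.update σ i 0, h0, fun j hj => ?_⟩
        rcases Finset.mem_insert.1 hj with rfl | hj
        · rw [Matrix.mulVec_add, Matrix.mulVec_mulVec, hsq, Matrix.one_mulVec]
          simp [add_comm]
        · rw [Function.update_of_ne (hne j hj), Matrix.mulVec_add, Matrix.mulVec_mulVec,
            (hcomm j i).eq, ← Matrix.mulVec_mulVec, h j hj, Matrix.mulVec_smul, smul_add]
  obtain ⟨ψ, σ, hψ, h⟩ := key Finset.univ
  exact ⟨ψ, σ, hψ, fun j => h j (Finset.mem_univ j)⟩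

theorem exists_smul_dotProduct_star_eq_one {m : Type*} [Fintype m] {ψ : m → ℂ} (hψ : ψ ≠ 0) :
    ∃ c : ℂ, star (c • ψ) ⬝ᵥ (c • ψ) = 1 := by
  have hr : star ψ ⬝ᵥ ψ = ((∑ u, Complex.normSq (ψ u) : ℝ) : ℂ) := by
    simp [dotProduct, Complex.normSq_eq_conj_mul_self]
  have hpos : 0 < ∑ u, Complex.normSq (ψ u) := by
    obtain ⟨u, hu⟩ := Function.ne_iff.1 hψ
    exact Finset.sum_pos' (fun _ _ => Complex.normSq_nonneg _)
      ⟨u, Finset.mem_univ u, Complex.normSq_pos.2 hu⟩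
  generalize ∑ u, Complex.normSq (ψ u) = r at hr hpos
  refine ⟨((√r)⁻¹ : ℝ), ?_⟩
  rw [star_smul, smul_dotProduct, dotProduct_smul, hr]
  simp only [smul_eq_mul, Complex.star_def, Complex.conj_ofReal, ← Complex.ofReal_mul]
  rw [← mul_assoc, ← mul_inv, Real.mul_self_sqrt hpos.le, inv_mul_cancel₀ hpos.ne',
    Complex.ofReal_one]

/-- Uniqueness, up to unitary equivalence, of systems of Hermitian involutions satisfying the
commutation relations of the Pauli generators. -/
theorem exists_unitary_intertwiner (X Z : Fin n → PMat n)
    (hXX : ∀ i j, Commute (X i) (X j)) (hZZ : ∀ i j, Commute (Z i) (Z j))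
    (hX2 : ∀ i, X i * X i = 1) (hZ2 : ∀ i, Z i * Z i = 1)
    (hXh : ∀ i, (X i).IsHermitian) (hZh : ∀ i, (Z i).IsHermitian)
    (hZX : ∀ i j, Z i * X j = (-1 : ℂ) ^ (eVec j i).val • (X j * Z i)) :
    ∃ U : PMat n, Uᴴ * U = 1 ∧ (∀ j, U * pauli (0, eVec j, 0) = X j * U) ∧
      ∀ j, U * pauli (0, 0, eVec j) = Z j * U := by
  obtain ⟨D, hD0, hD⟩ := exists_involution_products X hXX hX2
  have hDu : ∀ v, (D v)ᴴ * D v = 1 := by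
    refine bits_induction (by simp [hD0]) fun j v hv => ?_
    rw [hD, Matrix.conjTranspose_mul, (hXh j).eq, Matrix.mul_assoc, ← Matrix.mul_assoc (X j),
      hX2, Matrix.one_mul, hv]
  have hZD : ∀ i v, Z i * D v = (-1 : ℂ) ^ (v i).val • (D v * Z i) := by
    intro i
    refine bits_induction (by simp [hD0]) fun j v hv => ?_
    rw [hD, ← Matrix.mul_assoc, hZX, Matrix.smul_mul, Matrix.mul_assoc, hv, Matrix.mul_smul,
      smul_smul, Pi.add_apply, neg_one_pow_val_add, Matrix.mul_assoc]
  obtain ⟨ψ₀, σ, hψ₀, hσ⟩ := exists_joint_eigenvector Z hZZ hZ2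
  have hσ1 : D σ *ᵥ ψ₀ ≠ 0 := by
    intro h
    have := congrArg ((D σ)ᴴ *ᵥ ·) h
    simp only [Matrix.mulVec_mulVec, hDu, Matrix.one_mulVec, Matrix.mulVec_zero] at this
    exact hψ₀ this
  obtain ⟨c, hc⟩ := exists_smul_dotProduct_star_eq_one hσ1
  set ψ := c • D σ *ᵥ ψ₀ with hψ
  have hZψ : ∀ j, Z j *ᵥ ψ = ψ := by
    intro j
    rw [hψ, Matrix.mulVec_smul, Matrix.mulVec_mulVec, hZD, Matrix.smul_mulVec,
      ← Matrix.mulVec_mulVec, hσ, Matrix.mulVec_smul, smul_smul ((-1 : ℂ) ^ _),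
      ← mul_pow]
    simp
  have hZDψ : ∀ j v, Z j *ᵥ (D v *ᵥ ψ) = (-1 : ℂ) ^ (v j).val • (D v *ᵥ ψ) := by
    intro j v
    rw [Matrix.mulVec_mulVec, hZD, Matrix.smul_mulVec, ← Matrix.mulVec_mulVec, hZψ]
  let U : PMat n := fun u v => (D v *ᵥ ψ) u
  have hmulU : ∀ (A : PMat n) u v, (A * U) u v = (A *ᵥ (D v *ᵥ ψ)) u := fun _ _ _ => rfl
  refine ⟨U, ?_, fun j => ?_, fun j => ?_⟩
  · ext v w
    have hvw : (Uᴴ * U) v w = star (D v *ᵥ ψ) ⬝ᵥ (D w *ᵥ ψ) := rfl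
    rw [hvw]
    by_cases h : v = w
    · subst h
      rw [Matrix.one_apply_eq, Matrix.star_mulVec, ← Matrix.dotProduct_mulVec,
        Matrix.mulVec_mulVec, hDu, Matrix.one_mulVec, hc]
    · rw [Matrix.one_apply_ne h]
      obtain ⟨j, hj⟩ := Function.ne_iff.1 h
      have hZ : star (Z j *ᵥ (D v *ᵥ ψ)) ⬝ᵥ (D w *ᵥ ψ) =
          star (D v *ᵥ ψ) ⬝ᵥ (Z j *ᵥ (D w *ᵥ ψ)) := by
        rw [Matrix.star_mulVec, (hZh j).eq, ← Matrix.dotProduct_mulVec]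
      rw [hZDψ, hZDψ, star_smul, smul_dotProduct, dotProduct_smul, star_pow, star_neg,
        star_one, smul_eq_mul, smul_eq_mul] at hZ
      by_contra h0
      exact hj (neg_one_pow_val_injective (mul_right_cancel₀ h0 hZ))
  · ext u v
    rw [hmulU, Matrix.mulVec_mulVec, ← hD, add_comm, Matrix.mul_apply,
      Finset.sum_eq_single (v + eVec j)]
    · simp [pauli_apply, dotF2_eq_dotProduct, U]
    · intro w _ hw
      simp [pauli_apply, hw]
    · simp
  · ext u v
    rw [hmulU, hZDψ, Matrix.mul_apply, Finset.sum_eq_single v]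
    · have : dotF2 (eVec j) v = v j := by
        simp [dotF2_eq_dotProduct, eVec_eq_single]
      simp [pauli_apply, this, U, mul_comm]
    · intro w _ hw
      simp [pauli_apply, hw]
    · simp

end Intertwiner

section Tableau

variable {n : ℕ}

theorem pauli_mul_self {p : GG n} (h : (pauli p).IsHermitian) : pauli p * pauli p = 1 := by
  simpa only [h.eq] using pauli_mul_conjTranspose p

theorem sympForm_eq_iff {p q : GG n} {x : ZMod 2} :
    sympForm p q = x ↔ pauli p * pauli q = (-1 : ℂ) ^ x.val • (pauli q * pauli p) := by
  refine ⟨fun h => h ▸ pauli_mul_comm p q, fun h => ?_⟩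
  rw [pauli_mul_comm, pauli_mul] at h
  exact neg_one_pow_val_injective (smul_left_injective ℂ (pauli_ne_zero _) h)

/-- Rows of a flow tableau of a unitary matrix multiply as the generators do. -/
theorem pauli_row_mul {C : PMat n} (hC : C * Cᴴ = 1) {M : Fin (2 * n + 1) → GG n}
    (hM : ∀ i, pauli (M (rowIdx n i)) = Cᴴ * pauli (genElem i) * C) (i k : Fin n ⊕ Fin n) :
    pauli (M (rowIdx n i)) * pauli (M (rowIdx n k)) =
      Cᴴ * (pauli (genElem i) * pauli (genElem k)) * C := by
  rw [hM, hM]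
  calc _ = Cᴴ * pauli (genElem i) * (C * Cᴴ) * pauli (genElem k) * C := by
        simp only [Matrix.mul_assoc]
    _ = _ := by rw [hC, Matrix.mul_one]; simp only [Matrix.mul_assoc]

theorem phaseless_ne_zero {M : Fin (2 * n + 1) → GG n}
    (hM : ∀ i k, sympForm (M (rowIdx n i)) (M (rowIdx n k)) = Ωblk n i k) (i : Fin n ⊕ Fin n) :
    ((M (rowIdx n i)).2.1, (M (rowIdx n i)).2.2) ≠ (0, 0) := by
  intro h
  have hk := hM i i.swap
  rw [Prod.mk.injEq] at h
  rw [sympForm, h.1, h.2] at hk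
  rcases i with i | i <;> simp [Ωblk, dotF2_eq_dotProduct] at hk

theorem exists_clifford_of_tableau {M : Fin (2 * n + 1) → GG n} (h0 : M 0 = (1, 0, 0))
    (hh : ∀ i, (pauli (M (rowIdx n i))).IsHermitian)
    (hs : ∀ i k, sympForm (M (rowIdx n i)) (M (rowIdx n k)) = Ωblk n i k) :
    ∃ C : PMat n, IsCliffordUnitary C ∧ IsFlowTableau C M := by
  have hcomm : ∀ i k, Ωblk n i k = 0 →
      Commute (pauli (M (rowIdx n i))) (pauli (M (rowIdx n k))) := by
    intro i k hik
    simpa [hik, Commute, SemiconjBy] using sympForm_eq_iff.1 (hs i k)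
  obtain ⟨U, hU, hX, hZ⟩ := exists_unitary_intertwiner
    (fun j => pauli (M (rowIdx n (.inl j)))) (fun j => pauli (M (rowIdx n (.inr j))))
    (fun _ _ => hcomm _ _ rfl) (fun _ _ => hcomm _ _ rfl)
    (fun _ => pauli_mul_self (hh _)) (fun _ => pauli_mul_self (hh _))
    (fun _ => hh _) (fun _ => hh _) (fun i j => by
      rw [sympForm_eq_iff.1 (hs (.inr i) (.inl j))]
      simp [Ωblk, eVec, Matrix.one_apply])
  have hU' : U * Uᴴ = 1 := mul_eq_one_comm.1 hU
  have hgen : ∀ i, U * pauli (genElem i) * Uᴴ = pauli (M (rowIdx n i)) := by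
    intro i
    have : U * pauli (genElem i) = pauli (M (rowIdx n i)) * U := by
      rcases i with j | j
      exacts [hX j, hZ j]
    rw [this, Matrix.mul_assoc, hU', Matrix.mul_one]
  have hI : U * pauli (1, 0, 0) * Uᴴ = pauli (1, 0, 0) := by
    simp [pauli_one_zero, hU']
  refine ⟨Uᴴ, ⟨by simpa using hU, by simpa using hU', fun p => ?_⟩, fun i => ?_⟩
  · rw [Matrix.conjTranspose_conjTranspose]
    refine pauli_induction (Q := fun A => ∃ q : GG n, U * A * Uᴴ = pauli q) ?_ ?_ ?_ ?_ p
    · rintro a b ⟨p, hp⟩ ⟨q, hq⟩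
      refine ⟨gop p q, ?_⟩
      rw [← pauli_mul, ← hp, ← hq]
      calc U * (a * b) * Uᴴ = U * a * (1 : PMat n) * b * Uᴴ := by
            simp only [Matrix.mul_assoc, Matrix.mul_one]
        _ = _ := by rw [← hU]; simp only [Matrix.mul_assoc]
    · exact ⟨0, by rw [Matrix.mul_one, hU', pauli_one]⟩
    · exact ⟨_, hI⟩
    · exact fun i => ⟨_, hgen i⟩
  · change pauli (M i) = _
    rw [Matrix.conjTranspose_conjTranspose]
    rcases eq_zero_or_rowIdx i with rfl | ⟨k, rfl⟩
    · rw [h0, gens_zero, hI]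
    · rw [gens_rowIdx, hgen]

end Tableau

/-- M is the flow tableau of some Clifford unitary C iff the 0-th row
of M is (1|0|0), every other row is proper (nonzero phaseless part and
ε + ζ·ξᵀ ≡ 0 mod 2), and M is symplectic. -/
theorem stmt12 (n : ℕ) (hn : 1 ≤ n) (M : Fin (2 * n + 1) → GG n) :
    (∃ C : PMat n, IsCliffordUnitary C ∧ IsFlowTableau C M) ↔
      (M 0 = (1, 0, 0) ∧
       (∀ i : Fin n ⊕ Fin n,
          (((M (rowIdx n i)).2.1, (M (rowIdx n i)).2.2) ≠ (0, 0) ∧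
           ((M (rowIdx n i)).1.val +
             (dotF2 (M (rowIdx n i)).2.2 (M (rowIdx n i)).2.1).val) % 2 = 0)) ∧
       tabBlock M * Ωblk n * (tabBlock M)ᵀ = Ωblk n) := by
  have hsymp : tabBlock M * Ωblk n * (tabBlock M)ᵀ = Ωblk n ↔
      ∀ i k, sympForm (M (rowIdx n i)) (M (rowIdx n k)) = Ωblk n i k := by
    simp only [← Matrix.ext_iff, tabBlock_mul_apply]
  simp only [hsymp, ← pauli_isHermitian_iff]
  constructor
  · rintro ⟨C, ⟨hC, hC', -⟩, hM⟩
    have hrow : ∀ i, pauli (M (rowIdx n i)) = Cᴴ * pauli (genElem i) * C := fun i =>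
      (hM (rowIdx n i)).trans (by rw [gens_rowIdx])
    have hs : ∀ i k, sympForm (M (rowIdx n i)) (M (rowIdx n k)) = Ωblk n i k := by
      intro i k
      rw [sympForm_eq_iff, pauli_row_mul hC hrow, pauli_row_mul hC hrow,
        sympForm_eq_iff.1 (sympForm_genElem i k), Matrix.mul_smul, Matrix.smul_mul]
    refine ⟨pauli_injective ((hM 0).trans ?_), fun i => ⟨phaseless_ne_zero hs i, ?_⟩, hs⟩
    · simp [gens_zero, pauli_one_zero, hC']
    · rw [hrow]
      exact Matrix.isHermitian_conjTranspose_mul_mul C (genElem_isHermitian i)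
  · rintro ⟨h0, hp, hs⟩
    exact exists_clifford_of_tableau h0 (fun i => (hp i).2) hs
end

section
/- Let ϱ = (ϱ₀|ϱ₁…ϱₙ|ϱₙ₊₁…ϱ₂ₙ) ∈ Gₙ and let M be a (2n+1)-tuple of elements of Gₙ with rows m₀ = (ε₀|0|0) and mᵢ = (εᵢ|ξᵢ|ζᵢ) for 1 ≤ i ≤ 2n. Then ϱ ⊛ M = (2s|0|0) ⊛ (ϱ·M), where ϱ·M is the standard vector–matrix product (ϱ₀·ε₀ + Σ_{i≥1} ϱᵢεᵢ | Σ_{i≥1} ϱᵢξᵢ | Σ_{i≥1} ϱᵢζᵢ), with the phase component in ℤ₄ (bits ϱᵢ lifted to {0,1}) and the vector components in 𝔽₂ⁿ, and where the sign correction is s = Σ_{1≤i<j≤2n} ϱᵢ ϱⱼ (ζᵢ·ξⱼᵀ) ∈ 𝔽₂, lifted to {0,1} ⊆ ℤ₄. -/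
open Matrix

theorem two_mul_lift24_add (x y : ZMod 2) :
    2 * lift24 (x + y) = 2 * lift24 x + 2 * lift24 y := by
  revert x y; decide

theorem dotF2_sum_smul {n m : ℕ} (b : Fin m → ZMod 2) (v : Fin m → Fin n → ZMod 2)
    (w : Fin n → ZMod 2) :
    dotF2 (∑ i, b i • v i) w = ∑ i, b i * dotF2 (v i) w := by
  simp only [dotF2, Finset.sum_apply, Pi.smul_apply, smul_eq_mul, Finset.sum_mul, Finset.mul_sum,
    mul_assoc]
  exact Finset.sum_comm

theorem sum_lt_castSucc {R : Type*} [AddCommMonoid R] {m : ℕ}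
    (f : Fin (m + 1) → Fin (m + 1) → R) :
    (∑ i, ∑ j, if i < j then f i j else 0) =
      (∑ i : Fin m, ∑ j : Fin m, if i < j then f i.castSucc j.castSucc else 0) +
        ∑ i : Fin m, f i.castSucc (Fin.last m) := by
  simp [Fin.sum_univ_castSucc, Fin.castSucc_lt_last, Finset.sum_add_distrib, Fin.le_last,
    not_lt_of_ge]

/-- The ordered product of the rows selected by the bits `b`, in closed form. -/
theorem foldl_gop_filter_finRange {n m : ℕ} (a : ZMod 4) (b : Fin m → ZMod 2)
    (N : Fin m → GG n) :
    (((List.finRange m).filter (fun i => decide (b i = 1))).map N).foldl gop (a, 0, 0) =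
      (a + ∑ i, lift24 (b i) * (N i).1 +
          2 * lift24 (∑ i, ∑ j, if i < j then b i * b j * dotF2 (N i).2.2 (N j).2.1 else 0),
        ∑ i, b i • (N i).2.1, ∑ i, b i • (N i).2.2) := by
  induction m with
  | zero => simp [lift24]
  | succ m ih =>
    have key := ih (fun i => b i.castSucc) (fun i => N i.castSucc)
    rw [List.finRange_succ_last, List.filter_append, List.map_append, List.foldl_append,
      List.filter_map, List.map_map]
    simp only [Function.comp_def]
    rw [key, sum_lt_castSucc]
    have hb : b (Fin.last m) = 0 ∨ b (Fin.last m) = 1 := by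
      generalize b (Fin.last m) = x
      revert x; decide
    rcases hb with hb | hb
    · simp [hb, Fin.sum_univ_castSucc, lift24]
    · have h1 : lift24 1 = 1 := by decide
      simp only [hb, Fin.sum_univ_castSucc, gop, List.filter_cons, List.filter_nil, decide_true,
        if_true, List.map_cons, List.map_nil, List.foldl_cons, List.foldl_nil, dotF2_sum_smul,
        two_mul_lift24_add, h1, one_mul, mul_one, one_smul]
      refine Prod.ext ?_ rfl
      ring

/-- for ϱ ∈ Gₙ and a tableau M with 0-th row (ε₀|0|0),
ϱ ⊛ M = (2s|0|0) ⊛ (ϱ·M), where ϱ·M is the standard vector–matrix product and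
s = Σ_{1≤i<j≤2n} ϱᵢϱⱼ(ζᵢ·ξⱼᵀ) ∈ 𝔽₂. -/
theorem stmt13 (n : ℕ) (ϱ : GG n) (M : Fin (2 * n + 1) → GG n)
    (h0 : (M 0).2.1 = 0 ∧ (M 0).2.2 = 0) :
    starVecMul ϱ M =
      gop
        (2 * lift24 (∑ i : Fin (2 * n), ∑ j : Fin (2 * n),
            if i < j then
              bitOf ϱ i * bitOf ϱ j * dotF2 (M i.succ).2.2 (M j.succ).2.1
            else 0), 0, 0)
        (ϱ.1 * (M 0).1 + ∑ i : Fin (2 * n), lift24 (bitOf ϱ i) * (M i.succ).1,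
         ∑ i : Fin (2 * n), bitOf ϱ i • (M i.succ).2.1,
         ∑ i : Fin (2 * n), bitOf ϱ i • (M i.succ).2.2) := by
  rw [starVecMul, foldl_gop_filter_finRange]
  have hz : dotF2 (0 : Fin n → ZMod 2) (∑ i, bitOf ϱ i • (M i.succ).2.1) = 0 := by simp [dotF2]
  have hl : lift24 0 = 0 := by decide
  simp only [gop, hz, hl, mul_zero, add_zero, zero_add]
  rw [add_comm]
end
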